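/- arXiv:1302.6097 — 2 statements merged into one kernel-verified Lean document; each statement's English description precedes it below -/
import Mathlib

section
/- Let f ∈ ℤ[x] be a polynomial of degree n ≥ 2. If f(x + s) is not an Eisenstein polynomial for every integer s with 0 ≤ s ≤ n^{n/(n−1)} · L(f)², then f is not a shifted Eisenstein polynomial. -/
open Polynomial Filter

/-- `f ∈ ℤ[x]` is Eisenstein with respect to the prime `p`:
`p ∣ aᵢ` for all `i` below the degree, `p² ∤ a₀` and `p ∤ aₙ`. -/
def IsEisensteinWith (f : Polynomial ℤ) (p : ℕ) : Prop :=
  (∀ i < f.natDegree, (p : ℤ) ∣ f.coeff i) ∧ ¬ ((p : ℤ)^2 ∣ f.coeff 0) ∧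
    ¬ ((p : ℤ) ∣ f.leadingCoeff)
/-- `f` is an Eisenstein polynomial: it is Eisenstein with respect to some prime. -/
def IsEisenstein (f : Polynomial ℤ) : Prop :=
  ∃ p : ℕ, p.Prime ∧ IsEisensteinWith f p
/-- Length of an integer polynomial: the sum of the absolute values of its coefficients. -/
def polyLength (f : Polynomial ℤ) : ℤ :=
  ∑ i ∈ Finset.range (f.natDegree + 1), |f.coeff i|

/-- Translating an Eisenstein polynomial of degree at least two by a multiple of the prime
keeps it Eisenstein. -/
lemma IsEisensteinWith.comp_X_add_C_mul {g : ℤ[X]} {p : ℕ} (hg : IsEisensteinWith g p)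
    (hdeg : 2 ≤ g.natDegree) (t : ℤ) :
    IsEisensteinWith (g.comp (X + C ((p : ℤ) * t))) p := by
  obtain ⟨hcoeff, hsq, hlead⟩ := hg
  have hdeg' : (g.comp (X + C ((p : ℤ) * t))).natDegree = g.natDegree := by
    rw [natDegree_comp, natDegree_X_add_C, mul_one]
  have hmap : (g.comp (X + C ((p : ℤ) * t))).map (Int.castRingHom (ZMod p)) =
      g.map (Int.castRingHom (ZMod p)) := by
    simp [Polynomial.map_comp]
  have hmod (i : ℕ) : (((g.comp (X + C ((p : ℤ) * t))).coeff i : ℤ) : ZMod p) =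
      ((g.coeff i : ℤ) : ZMod p) := by
    simpa using congrArg (fun q => q.coeff i) hmap
  refine ⟨fun i hi => ?_, fun hdvd => hsq ?_, fun hdvd => hlead ?_⟩
  · rw [← ZMod.intCast_zmod_eq_zero_iff_dvd, hmod, ZMod.intCast_zmod_eq_zero_iff_dvd]
    exact hcoeff i (hdeg' ▸ hi)
  · obtain ⟨k, hk⟩ := g.binomExpansion 0 ((p : ℤ) * t)
    obtain ⟨c, hc⟩ := hcoeff 1 (by omega)
    have hder : g.derivative.eval 0 = g.coeff 1 := by
      rw [← coeff_zero_eq_eval_zero, coeff_derivative]; simp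
    have hzero : (g.comp (X + C ((p : ℤ) * t))).coeff 0 = g.eval (0 + (p : ℤ) * t) := by
      rw [coeff_zero_eq_eval_zero, eval_comp]; simp
    rw [hzero, hk, hder, hc, ← coeff_zero_eq_eval_zero] at hdvd
    have hrest : (p : ℤ) ^ 2 ∣ p * c * (p * t) + k * (p * t) ^ 2 :=
      ⟨c * t + k * t ^ 2, by ring⟩
    rw [add_assoc] at hdvd
    exact (dvd_add_left hrest).1 hdvd
  · rw [leadingCoeff, hdeg', ← ZMod.intCast_zmod_eq_zero_iff_dvd, hmod,
      ZMod.intCast_zmod_eq_zero_iff_dvd] at hdvd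
    exact hdvd

/-- If `f(x + s)` is Eisenstein with respect to `p`, then `f` is modulo `p` a multiple of
`(x - s)ⁿ`. -/
lemma IsEisensteinWith.intCast_coeff_eq {f : ℤ[X]} {p : ℕ} {s : ℤ}
    (hf : IsEisensteinWith (f.comp (X + C s)) p) (i : ℕ) :
    ((f.coeff i : ℤ) : ZMod p) = (f.leadingCoeff : ZMod p) *
      ((-(s : ZMod p)) ^ (f.natDegree - i) * (f.natDegree.choose i : ZMod p)) := by
  set g := f.comp (X + C s) with hg
  have hdeg : g.natDegree = f.natDegree := by
    rw [hg, natDegree_comp, natDegree_X_add_C, mul_one]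
  have hlead : g.leadingCoeff = f.leadingCoeff := by
    rw [hg, leadingCoeff_comp (by rw [natDegree_X_add_C]; exact one_ne_zero), leadingCoeff_X_add_C,
      one_pow, mul_one]
  have hgmap : g.map (Int.castRingHom (ZMod p)) =
      C (f.leadingCoeff : ZMod p) * X ^ f.natDegree := by
    ext k
    rw [coeff_map, coeff_C_mul_X_pow]
    rcases lt_trichotomy k f.natDegree with hk | hk | hk
    · rw [if_neg hk.ne]
      exact (ZMod.intCast_zmod_eq_zero_iff_dvd _ _).2 (hf.1 k (hdeg ▸ hk))
    · rw [if_pos hk, hk, ← hlead, leadingCoeff, hdeg]; rfl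
    · rw [if_neg hk.ne', coeff_eq_zero_of_natDegree_lt (hdeg ▸ hk), map_zero]
  have hfg : f = g.comp (X - C s) := by
    rw [hg, comp_assoc]; simp
  have hfmap : f.map (Int.castRingHom (ZMod p)) =
      C (f.leadingCoeff : ZMod p) * (X - C (s : ZMod p)) ^ f.natDegree := by
    conv_lhs => rw [hfg, Polynomial.map_comp, hgmap]
    simp
  have hi := congrArg (fun q => q.coeff i) hfmap
  rw [sub_eq_add_neg, ← C_neg] at hi
  simp only [coeff_C_mul, coeff_X_add_C_pow, coeff_map] at hi
  exact hi

/-- A binary form estimate used for the first nontrivial relation between the coefficients. -/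
lemma abs_two_mul_sub_le (n : ℕ) (hn : 1 ≤ n) (a b c L : ℤ) (hL : |a| + |b| + |c| ≤ L) :
    |2 * n * a * c - (n - 1) * b ^ 2| ≤ n * L ^ 2 := by
  have hn' : (1 : ℤ) ≤ n := by exact_mod_cast hn
  have ha := abs_nonneg a
  have hb := abs_nonneg b
  have hc := abs_nonneg c
  calc |2 * n * a * c - (n - 1) * b ^ 2|
      ≤ |2 * n * a * c| + |(n - 1) * b ^ 2| := abs_sub _ _
    _ = 2 * n * |a| * |c| + (n - 1) * |b| ^ 2 := by
      rw [abs_mul, abs_mul, abs_mul, abs_mul ((n : ℤ) - 1), abs_pow, Nat.abs_cast,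
        abs_of_nonneg (by linarith : (0 : ℤ) ≤ n - 1)]
      simp
    _ ≤ n * (|a| + |b| + |c|) ^ 2 := by
      have h1 : 0 ≤ (n : ℤ) * (|a| ^ 2 + |c| ^ 2 + 2 * |a| * |b| + 2 * |b| * |c|) := by
        positivity
      nlinarith [sq_nonneg |b|]
    _ ≤ n * L ^ 2 := by gcongr

/-- If `vʲ ≤ α · C(n, j)` with `2 ≤ j < n` and `L ≥ n + α`, then `(j + 1) v ≤ n L`. -/
lemma succ_mul_le_of_pow_le_mul_choose {n j v α L : ℕ} (hj : 2 ≤ j) (hjn : j < n)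
    (hv : v ^ j ≤ α * n.choose j) (hL : n + α ≤ L) : (j + 1) * v ≤ n * L := by
  have hchoose : j * n.choose j ≤ n ^ j := by
    calc j * n.choose j ≤ j.factorial * n.choose j := by
          gcongr; exact Nat.self_le_factorial j
      _ = n.descFactorial j := (Nat.descFactorial_eq_factorial_mul_choose n j).symm
      _ ≤ n ^ j := Nat.descFactorial_le_pow n j
  have hsq : 4 * (j + 1) * α ≤ L ^ 2 := by
    have h1 : (j + 1) + α ≤ L := by omega
    have h2 : ((j + 1) + α) ^ 2 ≤ L ^ 2 := by gcongr
    zify at h2 ⊢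
    nlinarith [sq_nonneg ((j : ℤ) + 1 - α)]
  obtain ⟨k, rfl⟩ := Nat.exists_eq_add_of_le' hj
  have hLpow : (k + 2 + 1) ^ (k + 2) * α ≤ (k + 2) * L ^ (k + 2) := by
    calc (k + 2 + 1) ^ (k + 2) * α
        = (k + 2 + 1) ^ k * ((k + 2 + 1) * ((k + 2 + 1) * α)) := by ring
      _ ≤ (k + 2 + 1) ^ k * ((4 * (k + 2)) * ((k + 2 + 1) * α)) := by gcongr; omega
      _ = (k + 2 + 1) ^ k * ((k + 2) * (4 * (k + 2 + 1) * α)) := by ring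
      _ ≤ L ^ k * ((k + 2) * L ^ 2) := by
          have hkL : k + 2 + 1 ≤ L := by omega
          exact Nat.mul_le_mul (Nat.pow_le_pow_left hkL k) (Nat.mul_le_mul_left _ hsq)
      _ = (k + 2) * L ^ (k + 2) := by ring
  refine (Nat.pow_le_pow_iff_left (n := k + 2) (Nat.succ_ne_zero _)).1 ?_
  refine le_of_mul_le_mul_left ?_ (by omega : 0 < k + 2)
  calc (k + 2) * ((k + 2 + 1) * v) ^ (k + 2)
      = (k + 2) * (k + 2 + 1) ^ (k + 2) * v ^ (k + 2) := by rw [mul_pow, mul_assoc]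
    _ ≤ (k + 2) * (k + 2 + 1) ^ (k + 2) * (α * n.choose (k + 2)) := by gcongr
    _ = (k + 2 + 1) ^ (k + 2) * α * ((k + 2) * n.choose (k + 2)) := by ring
    _ ≤ (k + 2) * L ^ (k + 2) * n ^ (k + 2) := by gcongr
    _ = (k + 2) * (n * L) ^ (k + 2) := by ring

/-- A sequence satisfying the recurrence of the coefficients of `b₀ (x + u/v)ⁿ` up to index `j`
agrees with these coefficients. -/
lemma pow_mul_eq_of_recurrence {n j : ℕ} (hjn : j ≤ n) {b : ℕ → ℤ} {u v : ℤ}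
    (h : ∀ i < j, ((i : ℤ) + 1) * v * b (i + 1) = (n - i) * u * b i) :
    v ^ j * b j = b 0 * n.choose j * u ^ j := by
  induction j with
  | zero => simp
  | succ j ih =>
    have ih := ih (by omega) fun i hi => h i (by omega)
    have hstep := h j (by omega)
    have hchoose : (n.choose (j + 1) : ℤ) * (j + 1) = n.choose j * (n - j) := by
      have := Nat.choose_succ_right_eq n j
      zify [show j ≤ n by omega] at this
      exact this
    have hj : ((j : ℤ) + 1) ≠ 0 := by positivity
    apply mul_left_cancel₀ hj
    calc ((j : ℤ) + 1) * (v ^ (j + 1) * b (j + 1))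
        = v ^ j * (((j : ℤ) + 1) * v * b (j + 1)) := by ring
      _ = (n - j) * u * (v ^ j * b j) := by rw [hstep]; ring
      _ = b 0 * (n.choose j * (n - j)) * u ^ (j + 1) := by rw [ih]; ring
      _ = _ := by rw [← hchoose]; ring

/-- The main estimate. Here `b j` is the coefficient of `x^(n-j)` of a polynomial that is
modulo `p` a multiple of `(x - s)ⁿ` but whose value at `s` is not divisible by `p²`. -/
lemma prime_le_of_recurrence {p n : ℕ} (hp : p.Prime) (hn : 2 ≤ n) (hnp : n < p)
    {b : ℕ → ℤ} {s L : ℤ} (hL : ∑ j ∈ Finset.range (n + 1), |b j| = L)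
    (hb0 : ¬ (p : ℤ) ∣ b 0) (hs : ¬ (p : ℤ) ∣ s)
    (hrec : ∀ j < n, (p : ℤ) ∣ (j + 1) * b (j + 1) + s * (n - j) * b j)
    (hsq : ¬ (p : ℤ) ^ 2 ∣ ∑ j ∈ Finset.range (n + 1), b j * s ^ (n - j)) :
    (p : ℤ) ≤ n * L ^ 2 := by
  have hpZ : Prime (p : ℤ) := Nat.prime_iff_prime_int.1 hp
  have hsmall (k : ℕ) (hk : 0 < k) (hkn : k ≤ n) : ¬ (p : ℤ) ∣ k := fun hd =>
    absurd (Nat.le_of_dvd hk (Int.natCast_dvd_natCast.1 hd)) (by omega)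
  have hnd : ∀ j ≤ n, ¬ (p : ℤ) ∣ b j := by
    intro j
    induction j with
    | zero => exact fun _ => hb0
    | succ j ih =>
      intro hj hd
      have h1 : (p : ℤ) ∣ s * (n - j) * b j :=
        (dvd_add_right (hd.mul_left _)).1 (hrec j (by omega))
      rcases hpZ.dvd_or_dvd h1 with h2 | h2
      · rcases hpZ.dvd_or_dvd h2 with h3 | h3
        · exact hs h3
        · apply hsmall (n - j) (by omega) (by omega)
          push_cast [show j ≤ n by omega]
          exact h3
      · exact ih (by omega) h2
  have hb_pos (j : ℕ) (hj : j ≤ n) : 1 ≤ |b j| :=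
    Int.one_le_abs fun h0 => hnd j hj (h0 ▸ dvd_zero _)
  have hsub (t : Finset ℕ) (ht : t ⊆ Finset.range (n + 1)) : ∑ j ∈ t, |b j| ≤ L :=
    hL ▸ Finset.sum_le_sum_of_subset_of_nonneg ht fun _ _ _ => abs_nonneg _
  have hL_ge : (n : ℤ) + |b 0| ≤ L := by
    rw [← hL, Finset.sum_range_succ']
    gcongr
    calc (n : ℤ) = ∑ _j ∈ Finset.range n, (1 : ℤ) := by simp
      _ ≤ _ := Finset.sum_le_sum fun j hj => hb_pos _ (by simp at hj; omega)
  have hsub2 (j : ℕ) (hj : j < n) : |b j| + |b (j + 1)| ≤ L := by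
    rw [← Finset.sum_pair (f := fun i => |b i|) (by omega : j ≠ j + 1)]
    exact hsub _ (by intro i; simp; omega)
  have hb0' : b 0 ≠ 0 := fun h0 => hb0 (h0 ▸ dvd_zero _)
  have hn0 : (n : ℤ) ≠ 0 := by positivity
  -- `u / v` is the reduced fraction `b 1 / (n * b 0)`
  obtain ⟨u, v, hv, hcop, huv⟩ :
      ∃ u v : ℤ, 0 < v ∧ IsCoprime u v ∧ v * b 1 = n * b 0 * u := by
    refine ⟨((b 1 : ℚ) / ((n * b 0 : ℤ) : ℚ)).num, ((b 1 : ℚ) / ((n * b 0 : ℤ) : ℚ)).den,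
      by exact_mod_cast Rat.den_pos _, ?_, ?_⟩
    · exact Rat.isCoprime_num_den _
    · have h1 := Rat.num_div_den ((b 1 : ℚ) / ((n * b 0 : ℤ) : ℚ))
      have h2 : ((n * b 0 : ℤ) : ℚ) ≠ 0 := by exact_mod_cast mul_ne_zero hn0 hb0'
      have h3 : ((((b 1 : ℚ) / ((n * b 0 : ℤ) : ℚ)).den : ℤ) : ℚ) ≠ 0 := by
        exact_mod_cast Rat.den_ne_zero _
      rw [Int.cast_natCast] at h3
      rw [div_eq_div_iff h3 h2] at h1
      have h4 : ((b 1 : ℚ) / ((n * b 0 : ℤ) : ℚ)).num * (n * b 0) =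
          b 1 * ((b 1 : ℚ) / ((n * b 0 : ℤ) : ℚ)).den := by exact_mod_cast h1
      linear_combination -h4
  have hu_dvd : u ∣ b 1 := hcop.dvd_of_dvd_mul_left (huv ▸ Dvd.intro_left _ rfl)
  have hv_dvd : v ∣ n * b 0 :=
    hcop.symm.dvd_of_dvd_mul_right (huv ▸ Dvd.intro _ rfl)
  have hnb0 : ¬ (p : ℤ) ∣ n * b 0 := fun hd =>
    (hpZ.dvd_or_dvd hd).elim (hsmall n (by omega) le_rfl) hb0
  have hpv : ¬ (p : ℤ) ∣ v := fun hd => hnb0 (hd.trans hv_dvd)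
  have hpu : ¬ (p : ℤ) ∣ u := fun hd => hnd 1 (by omega) (hd.trans hu_dvd)
  have hlin : (p : ℤ) ∣ u + s * v := by
    have h1 := (hrec 0 (by omega)).mul_left v
    have h2 : v * (((0 : ℕ) + 1) * b (0 + 1) + s * (n - (0 : ℕ)) * b 0) =
        n * b 0 * (u + s * v) := by
      push_cast
      linear_combination huv
    rw [h2] at h1
    exact (hpZ.dvd_or_dvd h1).resolve_left hnb0
  have hmod (j : ℕ) (hj : j < n) :
      (p : ℤ) ∣ (j + 1) * v * b (j + 1) - (n - j) * u * b j := by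
    have h1 := dvd_sub ((hrec j hj).mul_left v) (hlin.mul_left ((n - j) * b j))
    have h2 : v * (((j : ℤ) + 1) * b (j + 1) + s * (n - j) * b j) -
        (n - j) * b j * (u + s * v) = (j + 1) * v * b (j + 1) - (n - j) * u * b j := by
      ring
    rwa [h2] at h1
  have hu_le : |u| ≤ L := by
    have h1 : |u| ≤ |b 1| :=
      Int.le_of_dvd (hb_pos 1 (by omega)) ((abs_dvd_abs _ _).2 hu_dvd)
    have := hsub2 0 (by omega)
    have := abs_nonneg (b 0)
    simp only [zero_add] at *
    linarith
  by_cases hall : ∀ j < n, ((j : ℤ) + 1) * v * b (j + 1) = (n - j) * u * b j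
  · exfalso
    have hval : v ^ n * ∑ j ∈ Finset.range (n + 1), b j * s ^ (n - j) =
        b 0 * (u + s * v) ^ n := by
      rw [add_pow, Finset.mul_sum, Finset.mul_sum]
      refine Finset.sum_congr rfl fun j hj => ?_
      have hjn : j ≤ n := by simp at hj; omega
      have h1 := pow_mul_eq_of_recurrence hjn fun i hi => hall i (by omega)
      have h2 : v ^ n = v ^ j * v ^ (n - j) := by rw [← pow_add]; congr 1; omega
      rw [h2, mul_pow]
      linear_combination (v ^ (n - j) * s ^ (n - j)) * h1
    have h1 : (p : ℤ) ^ 2 ∣ v ^ n * ∑ j ∈ Finset.range (n + 1), b j * s ^ (n - j) := by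
      rw [hval]
      exact ((pow_dvd_pow_of_dvd hlin 2).trans (pow_dvd_pow _ hn)).mul_left _
    have h2 : IsCoprime ((p : ℤ) ^ 2) (v ^ n) :=
      ((hpZ.irreducible.coprime_iff_not_dvd).2 hpv).pow
    exact hsq (h2.dvd_of_dvd_mul_left h1)
  · push Not at hall
    classical
    obtain ⟨hjn, hne⟩ := Nat.find_spec hall
    have hmin (i : ℕ) (hi : i < Nat.find hall) :
        ((i : ℤ) + 1) * v * b (i + 1) = (n - i) * u * b i := by
      by_contra hcon
      exact Nat.find_min hall hi ⟨by omega, hcon⟩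
    set j := Nat.find hall
    have hj0 : j ≠ 0 := fun h0 => hne (by
      rw [h0]; push_cast; linear_combination huv)
    rcases (show j = 1 ∨ 2 ≤ j by omega) with hj1 | hj2
    · rw [hj1] at hne
      have hkey : u * (2 * n * b 0 * b 2 - (n - 1) * b 1 ^ 2) =
          b 1 * ((((1 : ℕ) : ℤ) + 1) * v * b (1 + 1) - (n - ((1 : ℕ) : ℤ)) * u * b 1) := by
        push_cast
        linear_combination (-2 * b 2) * huv
      have hpd : (p : ℤ) ∣ 2 * n * b 0 * b 2 - (n - 1) * b 1 ^ 2 :=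
        (hpZ.dvd_or_dvd (hkey ▸ (hmod 1 (by omega)).mul_left (b 1))).resolve_left hpu
      have hD : 2 * n * b 0 * b 2 - (n - 1) * b 1 ^ 2 ≠ 0 := by
        intro h0
        rw [h0, mul_zero] at hkey
        rcases mul_eq_zero.1 hkey.symm with h1 | h1
        · exact hnd 1 (by omega) (h1 ▸ dvd_zero _)
        · exact hne (sub_eq_zero.1 h1)
      have h3 : |b 0| + |b 1| + |b 2| ≤ L := by
        have := hsub (Finset.range 3) (by intro i; simp; omega)
        simpa [Finset.sum_range_succ] using this
      exact (Int.le_of_dvd (abs_pos.2 hD) ((dvd_abs _ _).2 hpd)).trans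
        (abs_two_mul_sub_le n (by omega) _ _ _ _ h3)
    · have hpow := pow_mul_eq_of_recurrence hjn.le hmin
      have hvj : v ^ j ∣ b 0 * n.choose j :=
        hcop.symm.pow.dvd_of_dvd_mul_right (hpow ▸ Dvd.intro _ rfl)
      have hvle : v.natAbs ^ j ≤ (b 0).natAbs * n.choose j := by
        have h1 := Int.natAbs_dvd_natAbs.2 hvj
        rw [Int.natAbs_pow, Int.natAbs_mul, Int.natAbs_natCast] at h1
        exact Nat.le_of_dvd (Nat.mul_pos (Int.natAbs_pos.2 hb0') (Nat.choose_pos hjn.le)) h1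
      have hvL : ((j : ℤ) + 1) * v ≤ n * L := by
        have h1 := succ_mul_le_of_pow_le_mul_choose hj2 hjn hvle
          (L := L.natAbs) (by zify; exact hL_ge.trans (le_abs_self L))
        zify at h1
        rwa [abs_of_pos hv, abs_of_nonneg (by linarith [abs_nonneg (b 0)] : 0 ≤ L)] at h1
      have hL0 : 0 ≤ L := (abs_nonneg u).trans hu_le
      have hnj : (0 : ℤ) ≤ n - j := sub_nonneg.2 (by exact_mod_cast hjn.le)
      calc (p : ℤ) ≤ |(j + 1) * v * b (j + 1) - (n - j) * u * b j| :=
            Int.le_of_dvd (abs_pos.2 (sub_ne_zero.2 hne)) ((dvd_abs _ _).2 (hmod j hjn))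
        _ ≤ |((j : ℤ) + 1) * v * b (j + 1)| + |(n - j) * u * b j| := abs_sub _ _
        _ = ((j : ℤ) + 1) * v * |b (j + 1)| + (n - j) * |u| * |b j| := by
          rw [abs_mul, abs_mul _ (b j), abs_mul _ u, abs_of_nonneg hnj,
            abs_of_nonneg (by positivity : 0 ≤ ((j : ℤ) + 1) * v)]
        _ ≤ n * L * |b (j + 1)| + n * L * |b j| := by
          gcongr
          linarith
        _ = n * L * (|b j| + |b (j + 1)|) := by ring
        _ ≤ n * L * L := by
          gcongr
          exact hsub2 j hjn
        _ = n * L ^ 2 := by ring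

/-- If `f(x + s)` is Eisenstein with respect to `p` and `p ∤ s`, then `p ≤ n · L(f)²`. -/
lemma IsEisensteinWith.prime_le {f : ℤ[X]} {p : ℕ} {s : ℤ}
    (hf : IsEisensteinWith (f.comp (X + C s)) p) (hp : p.Prime) (hdeg : 2 ≤ f.natDegree)
    (hs : ¬ (p : ℤ) ∣ s) : (p : ℤ) ≤ f.natDegree * polyLength f ^ 2 := by
  set n := f.natDegree with hn
  have hlead : (f.comp (X + C s)).leadingCoeff = f.coeff n := by
    rw [leadingCoeff_comp (by rw [natDegree_X_add_C]; exact one_ne_zero), leadingCoeff_X_add_C, one_pow,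
      mul_one]
    rfl
  rcases le_or_gt p n with hpn | hpn
  · have h1 : 1 ≤ polyLength f := by
      have h0 : f.coeff n ≠ 0 := by
        intro h0
        exact hf.2.2 (by rw [hlead, h0]; exact dvd_zero _)
      exact (Int.one_le_abs h0).trans (Finset.single_le_sum (f := fun i => |f.coeff i|)
        (fun _ _ => abs_nonneg _) (by simp [hn]))
    have h2 : (p : ℤ) ≤ n := by exact_mod_cast hpn
    calc (p : ℤ) ≤ n := h2
      _ ≤ n * polyLength f ^ 2 := le_mul_of_one_le_right (by positivity) (one_le_pow₀ h1)
  · refine prime_le_of_recurrence hp hdeg hpn (b := fun j => f.coeff (n - j)) (s := s)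
      ?_ ?_ hs ?_ ?_
    · exact Finset.sum_range_reflect (fun i => |f.coeff i|) (n + 1)
    · exact hlead ▸ hf.2.2
    · intro j hj
      rw [← ZMod.intCast_zmod_eq_zero_iff_dvd]
      push_cast
      rw [hf.intCast_coeff_eq, hf.intCast_coeff_eq, ← hn, Nat.choose_symm hj.le,
        Nat.choose_symm (by omega : j + 1 ≤ n), Nat.sub_sub_self hj.le,
        Nat.sub_sub_self (by omega : j + 1 ≤ n)]
      have hchoose : (n.choose (j + 1) : ZMod p) * (j + 1) = n.choose j * (n - j) := by
        have := congrArg (Nat.cast (R := ZMod p)) (Nat.choose_succ_right_eq n j)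
        push_cast [hj.le] at this
        exact this
      linear_combination (f.leadingCoeff : ZMod p) * (-(s : ZMod p)) ^ (j + 1) * hchoose
    · have h0 : (f.comp (X + C s)).coeff 0 =
          ∑ j ∈ Finset.range (n + 1), f.coeff (n - j) * s ^ (n - j) := by
        rw [coeff_zero_eq_eval_zero, eval_comp]
        simp only [eval_add, eval_X, eval_C, zero_add]
        rw [eval_eq_sum_range, ← Finset.sum_range_reflect]
        rfl
      exact h0 ▸ hf.2.1

/-- If `f` of degree `n ≥ 2` satisfies that `f(x+s)` is not Eisenstein for every integer `s`
with `0 ≤ s ≤ n^(n/(n-1)) · L(f)²`, then `f` is not a shifted Eisenstein polynomial. -/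
theorem not_shifted_eisenstein_of_small_shifts (n : ℕ) (hn : 2 ≤ n) (f : Polynomial ℤ)
    (hdeg : f.natDegree = n)
    (h : ∀ s : ℤ, 0 ≤ s →
      (s : ℝ) ≤ (n : ℝ) ^ ((n : ℝ) / ((n : ℝ) - 1)) * (polyLength f : ℝ)^2 →
      ¬ IsEisenstein (f.comp (X + C s))) :
    ¬ ∃ s : ℤ, IsEisenstein (f.comp (X + C s)) := by
  rintro ⟨s, p, hp, hE⟩
  have hp0 : (0 : ℤ) < p := by exact_mod_cast hp.pos
  have hE' : IsEisensteinWith (f.comp (X + C (s % p))) p := by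
    have h1 := hE.comp_X_add_C_mul
      (by rw [natDegree_comp, natDegree_X_add_C, mul_one]; omega) (-(s / p))
    have h2 : (X + C s : ℤ[X]).comp (X + C ((p : ℤ) * -(s / p))) = X + C (s % p) := by
      rw [add_comp, X_comp, C_comp, add_assoc, ← C_add, Int.emod_def]
      congr 2
      ring
    rwa [comp_assoc, h2] at h1
  have hnonneg : 0 ≤ s % p := Int.emod_nonneg _ hp0.ne'
  have hlt : s % p < p := Int.emod_lt_of_pos _ hp0
  refine h (s % p) hnonneg ?_ ⟨p, hp, hE'⟩
  by_cases hzero : s % p = 0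
  · rw [hzero, Int.cast_zero]
    positivity
  · have hnd : ¬ (p : ℤ) ∣ s % p := fun hd =>
      absurd (Int.le_of_dvd (by omega) hd) (by omega)
    have hle := hlt.le.trans (hE'.prime_le hp (by omega) hnd)
    rw [hdeg] at hle
    have hn1 : (1 : ℝ) ≤ n := by exact_mod_cast (by omega : 1 ≤ n)
    have hn2 : (0 : ℝ) < (n : ℝ) - 1 := by
      have : (2 : ℝ) ≤ n := by exact_mod_cast hn
      linarith
    have hpow : (n : ℝ) ≤ (n : ℝ) ^ ((n : ℝ) / ((n : ℝ) - 1)) :=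
      Real.self_le_rpow_of_one_le hn1 ((one_le_div hn2).2 (by linarith))
    calc ((s % p : ℤ) : ℝ) ≤ (n : ℝ) * (polyLength f : ℝ) ^ 2 := by exact_mod_cast hle
      _ ≤ _ := by gcongr
end

section
/- For every integer n > 2 there exists a constant C > 0 (depending only on n) such that for all integers H ≥ 1, |#E_n(H) − ρ_n · 2^{n+1} · H^{n+1}| ≤ C · H^n. -/
open Polynomial Filter

/-- Height of an integer polynomial: the maximum of the absolute values of its coefficients. -/
def polyHeight (f : Polynomial ℤ) : ℕ :=
  (Finset.range (f.natDegree + 1)).sup fun i => (f.coeff i).natAbs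
/-- `E_n(H)`: the set of Eisenstein polynomials of degree exactly `n` and height at most `H`. -/
def EisensteinSet (n H : ℕ) : Set (Polynomial ℤ) :=
  {f | f.natDegree = n ∧ polyHeight f ≤ H ∧ IsEisenstein f}
/-- `ρₙ = 1 - ∏_p (1 - (p-1)²/pⁿ⁺²)`, the product running over all primes. -/
noncomputable def rho (n : ℕ) : ℝ :=
  1 - ∏' p : Nat.Primes, (1 - ((p : ℕ) - 1 : ℝ)^2 / ((p : ℕ) : ℝ)^(n + 2))

open ArithmeticFunction in
/-- `∑_{d ∣ m} μ(d)` is `1` if `m = 1` and `0` otherwise. -/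
theorem sum_divisors_moebius (m : ℕ) :
    ∑ d ∈ m.divisors, moebius d = if m = 1 then 1 else 0 := by
  rw [← coe_mul_zeta_apply, moebius_mul_coe_zeta, one_apply]

open ArithmeticFunction in
/-- `∑_{d ∣ s} μ(d) / d = φ(s) / s`. -/
theorem sum_divisors_moebius_div {s : ℕ} (hs : 0 < s) :
    ∑ d ∈ s.divisors, (moebius d : ℝ) / d = (s.totient : ℝ) / s := by
  have h := (sum_eq_iff_sum_mul_moebius_eq (R := ℝ) (f := fun k => (k.totient : ℝ))
    (g := fun k => (k : ℝ))).1 (fun k _ => by exact_mod_cast Nat.sum_totient k) s hs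
  rw [eq_div_iff (by positivity), ← h, Nat.sum_divisorsAntidiagonal
    (fun d e => ((moebius d : ℤ) : ℝ) * (e : ℝ)), Finset.sum_mul]
  refine Finset.sum_congr rfl fun d hd => ?_
  have hd' := Nat.dvd_of_mem_divisors hd
  have : (d : ℝ) ≠ 0 := by exact_mod_cast (Nat.pos_of_mem_divisors hd).ne'
  rw [Nat.cast_div hd' this]
  ring

theorem card_divisors_le_two_mul_sqrt (s : ℕ) : (s.divisors.card : ℝ) ≤ 2 * √s := by
  have hsub : s.divisors ⊆ Finset.Icc 1 s.sqrt ∪ (Finset.Icc 1 s.sqrt).image (s / ·) := by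
    intro d hd
    obtain ⟨⟨e, rfl⟩, h0⟩ := Nat.mem_divisors.1 hd
    have hd0 : 0 < d := Nat.pos_of_ne_zero fun h => h0 (by simp [h])
    have he0 : 0 < e := Nat.pos_of_ne_zero fun h => h0 (by simp [h])
    simp only [Finset.mem_union, Finset.mem_image, Finset.mem_Icc, Nat.le_sqrt]
    rcases le_total d e with h | h
    · exact Or.inl ⟨hd0, Nat.mul_le_mul_left d h⟩
    · exact Or.inr ⟨e, ⟨he0, Nat.mul_le_mul_right e h⟩, Nat.mul_div_cancel _ he0⟩
  have hcard : s.divisors.card ≤ 2 * s.sqrt := by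
    calc _ ≤ _ := Finset.card_le_card hsub
      _ ≤ _ := Finset.card_union_le _ _
      _ ≤ s.sqrt + s.sqrt := by
        gcongr
        · simp
        · exact Finset.card_image_le.trans (by simp)
      _ = _ := by ring
  calc (s.divisors.card : ℝ) ≤ 2 * s.sqrt := by exact_mod_cast hcard
    _ ≤ _ := by gcongr; exact Real.nat_sqrt_le_real_sqrt

/-- Dividing by `d` counts the multiples of `d` in `[-N, N]` whose quotient satisfies `P`. -/
theorem card_filter_dvd_and_Icc (N : ℕ) {d : ℕ} (hd : 0 < d) (P : ℤ → Prop) [DecidablePred P] :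
    ((Finset.Icc (-(N : ℤ)) N).filter fun b => (d : ℤ) ∣ b ∧ P (b / d)).card =
      ((Finset.Icc (-((N / d : ℕ) : ℤ)) (N / d : ℕ)).filter P).card := by
  have hd' : (0 : ℤ) < d := by exact_mod_cast hd
  symm
  refine Finset.card_bij (fun b _ => d * b) ?_ ?_ ?_
  · intro b hb
    simp only [Finset.mem_filter, Finset.mem_Icc, Int.natCast_ediv] at hb ⊢
    obtain ⟨⟨h1, h2⟩, h3⟩ := hb
    rw [Int.le_ediv_iff_mul_le hd'] at h2
    have h4 : -b ≤ (N : ℤ) / d := by omega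
    rw [Int.le_ediv_iff_mul_le hd'] at h4
    refine ⟨⟨by linarith, by linarith⟩, dvd_mul_right _ _, ?_⟩
    rwa [Int.mul_ediv_cancel_left _ hd'.ne']
  · intro a _ b _ h
    exact mul_left_cancel₀ hd'.ne' h
  · intro b hb
    simp only [Finset.mem_filter, Finset.mem_Icc] at hb
    obtain ⟨⟨h1, h2⟩, ⟨c, rfl⟩, h3⟩ := hb
    rw [Int.mul_ediv_cancel_left _ hd'.ne'] at h3
    refine ⟨c, ?_, rfl⟩
    simp only [Finset.mem_filter, Finset.mem_Icc, Int.natCast_ediv]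
    have h4 : c ≤ (N : ℤ) / d := by rw [Int.le_ediv_iff_mul_le hd']; linarith
    have h5 : -c ≤ (N : ℤ) / d := by rw [Int.le_ediv_iff_mul_le hd']; linarith
    exact ⟨⟨by omega, h4⟩, h3⟩

theorem card_filter_dvd_Icc (N : ℕ) {d : ℕ} (hd : 0 < d) :
    ((Finset.Icc (-(N : ℤ)) N).filter fun b => (d : ℤ) ∣ b).card = 2 * (N / d) + 1 := by
  have h := card_filter_dvd_and_Icc N hd (fun _ => True)
  simp only [and_true, Finset.filter_true, Int.card_Icc] at h
  omega

theorem abs_two_mul_div_add_one_sub_le (N : ℕ) {d : ℕ} (hd : 0 < d) :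
    |((2 * (N / d) + 1 : ℕ) : ℝ) - 2 * N / d| ≤ 1 := by
  have hd' : (0 : ℝ) < d := by exact_mod_cast hd
  have h1 : ((N / d : ℕ) : ℝ) ≤ N / d := Nat.cast_div_le
  have h2 : (N : ℝ) / d < (N / d : ℕ) + 1 := by
    rw [div_lt_iff₀ hd']
    exact_mod_cast Nat.lt_mul_of_div_lt (Nat.lt_succ_self _) hd
  push_cast
  rw [abs_le, mul_div_assoc]
  constructor <;> linarith

/-- The integers in `[-N, N]` coprime to `s`. -/
noncomputable def coprimeIcc (N s : ℕ) : Finset ℤ :=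
  (Finset.Icc (-(N : ℤ)) N).filter fun b => b.natAbs.Coprime s

open ArithmeticFunction in
theorem abs_card_coprimeIcc_sub_le (N : ℕ) {t s : ℕ} (ht : 0 < t) (hs : 0 < s) :
    |((coprimeIcc (N / t) s).card : ℝ) - 2 * N / t * (s.totient / s)| ≤ s.divisors.card := by
  have key : ((coprimeIcc (N / t) s).card : ℤ) =
      ∑ d ∈ s.divisors, moebius d * ((2 * (N / (t * d)) + 1 : ℕ) : ℤ) := by
    calc ((coprimeIcc (N / t) s).card : ℤ)
        = ∑ b ∈ Finset.Icc (-((N / t : ℕ) : ℤ)) (N / t : ℕ),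
          ∑ d ∈ s.divisors, if (d : ℤ) ∣ b then moebius d else 0 := by
          rw [coprimeIcc, Finset.card_filter]
          push_cast
          refine Finset.sum_congr rfl fun b _ => ?_
          simp only [Nat.coprime_iff_gcd_eq_one]
          rw [← Finset.sum_filter, ← sum_divisors_moebius]
          refine Finset.sum_congr ?_ fun _ _ => rfl
          ext d
          simp only [Nat.mem_divisors, Finset.mem_filter, Nat.dvd_gcd_iff, Int.natCast_dvd]
          have : b.natAbs.gcd s ≠ 0 := (Nat.gcd_pos_of_pos_right _ hs).ne'
          have := hs.ne'
          tauto
      _ = _ := by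
          rw [Finset.sum_comm]
          refine Finset.sum_congr rfl fun d hd => ?_
          rw [← Nat.div_div_eq_div_mul, ← card_filter_dvd_Icc _ (Nat.pos_of_mem_divisors hd),
            ← Finset.sum_filter, Finset.sum_const, nsmul_eq_mul, mul_comm]
  have key' : ((coprimeIcc (N / t) s).card : ℝ) =
      ∑ d ∈ s.divisors, (moebius d : ℝ) * ((2 * (N / (t * d)) + 1 : ℕ) : ℝ) := by
    have h := congrArg (Int.cast : ℤ → ℝ) key
    push_cast at h ⊢
    exact h
  rw [key', ← sum_divisors_moebius_div hs, Finset.mul_sum, ← Finset.sum_sub_distrib,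
    Finset.card_eq_sum_ones, Nat.cast_sum]
  refine (Finset.abs_sum_le_sum_abs _ _).trans (Finset.sum_le_sum fun d hd => ?_)
  have hd := Nat.pos_of_mem_divisors hd
  have e : (moebius d : ℝ) * ((2 * (N / (t * d)) + 1 : ℕ) : ℝ) - 2 * N / t * (moebius d / d) =
      moebius d * (((2 * (N / (t * d)) + 1 : ℕ) : ℝ) - 2 * N / (t * d : ℕ)) := by
    push_cast; field_simp
  rw [e, abs_mul, Nat.cast_one]
  have hmu : |(moebius d : ℝ)| ≤ 1 := by exact_mod_cast abs_moebius_le_one (n := d)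
  exact mul_le_one₀ hmu (abs_nonneg _) (abs_two_mul_div_add_one_sub_le N (Nat.mul_pos ht hd))

/-- The Eisenstein condition at `p` for the vector `(a₀, …, aₙ)` of coefficients, `n = m + 1`. -/
def IsEisensteinVec {m : ℕ} (a : Fin (m + 2) → ℤ) (p : ℕ) : Prop :=
  (∀ i : Fin (m + 1), (p : ℤ) ∣ a i.castSucc) ∧ ¬ ((p : ℤ) ^ 2 ∣ a 0) ∧
    ¬ ((p : ℤ) ∣ a (Fin.last (m + 1)))

/-- The vectors of `m + 2` integer coefficients of absolute value at most `H`. -/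
noncomputable def coeffBox (m H : ℕ) : Finset (Fin (m + 2) → ℤ) :=
  Fintype.piFinset fun _ => Finset.Icc (-(H : ℤ)) H

theorem mem_coeffBox {m H : ℕ} {a : Fin (m + 2) → ℤ} :
    a ∈ coeffBox m H ↔ ∀ i, (a i).natAbs ≤ H := by
  simp only [coeffBox, Fintype.mem_piFinset, Finset.mem_Icc]
  exact forall_congr' fun i => by omega

theorem isEisensteinWith_iff_toFn {m : ℕ} {f : ℤ[X]} (hf : f.natDegree = m + 1) (p : ℕ) :
    IsEisensteinWith f p ↔ IsEisensteinVec (toFn (m + 2) f) p := by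
  simp only [IsEisensteinWith, IsEisensteinVec, leadingCoeff, hf, toFn, LinearMap.pi_apply,
    lcoeff_apply, Fin.val_castSucc, Fin.val_last, Fin.val_zero, Fin.forall_iff]

theorem polyHeight_le_iff_toFn {m H : ℕ} {f : ℤ[X]} (hf : f.natDegree = m + 1) :
    polyHeight f ≤ H ↔ toFn (m + 2) f ∈ coeffBox m H := by
  simp only [polyHeight, mem_coeffBox, hf, Finset.sup_le_iff, Finset.mem_range, toFn,
    LinearMap.pi_apply, lcoeff_apply, Fin.forall_iff]

open Classical in
theorem card_eisensteinSet_eq (m H : ℕ) :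
    Nat.card (EisensteinSet (m + 1) H) =
      ((coeffBox m H).filter fun a => ∃ p : ℕ, p.Prime ∧ IsEisensteinVec a p).card := by
  rw [Nat.card_coe_set_eq, ← Set.ncard_coe_finset]
  refine Set.ncard_congr (fun f _ => toFn (m + 2) f) ?_ ?_ ?_
  · rintro f ⟨hf, hH, p, hp, he⟩
    simp only [Finset.coe_filter, Set.mem_ofPred_eq]
    exact ⟨(polyHeight_le_iff_toFn hf).1 hH, p, hp, (isEisensteinWith_iff_toFn hf p).1 he⟩
  · rintro f g ⟨hf, -⟩ ⟨hg, -⟩ h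
    rw [← ofFn_comp_toFn_eq_id_of_natDegree_lt (show f.natDegree < m + 2 by omega), h,
      ofFn_comp_toFn_eq_id_of_natDegree_lt (show g.natDegree < m + 2 by omega)]
  · intro a ha
    simp only [Finset.coe_filter, Set.mem_ofPred_eq] at ha
    obtain ⟨hH, p, hp, he⟩ := ha
    have hdeg : (ofFn (m + 2) a).natDegree = m + 1 := by
      refine le_antisymm (Nat.le_of_lt_succ (ofFn_natDegree_lt (by omega) a))
        (le_natDegree_of_ne_zero ?_)
      rw [ofFn_coeff_eq_val_of_lt a (by omega)]
      intro h0
      exact he.2.2 (by rw [show Fin.last (m + 1) = ⟨m + 1, by omega⟩ from rfl, h0]; simp)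
    have hto := toFn_comp_ofFn_eq_id (m + 2) a
    refine ⟨ofFn (m + 2) a, ⟨hdeg, ?_, p, hp, ?_⟩, hto⟩
    · rwa [polyHeight_le_iff_toFn hdeg, hto]
    · rwa [isEisensteinWith_iff_toFn hdeg, hto]

/-- A squarefree `s` divides `x` as soon as all its prime factors do. -/
theorem natCast_dvd_of_squarefree {s : ℕ} (hs : Squarefree s) {x : ℤ}
    (h : ∀ p ∈ s.primeFactors, (p : ℤ) ∣ x) : (s : ℤ) ∣ x := by
  rw [Int.natCast_dvd, ← Nat.prod_primeFactors_of_squarefree hs]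
  exact Finset.prod_primes_dvd _ (fun p hp => (Nat.prime_of_mem_primeFactors hp).prime)
    fun p hp => Int.natCast_dvd.1 (h p hp)

theorem natAbs_coprime_iff {s : ℕ} (hs : s ≠ 0) (x : ℤ) :
    x.natAbs.Coprime s ↔ ∀ p ∈ s.primeFactors, ¬ (p : ℤ) ∣ x := by
  simp only [Int.natCast_dvd, Nat.mem_primeFactors]
  constructor
  · rintro h p ⟨hp, hps, -⟩ hpx
    exact Nat.not_coprime_of_dvd_of_dvd hp.one_lt hpx hps h
  · intro h
    refine Nat.coprime_of_dvd fun p hp hpx hps => h p ⟨hp, hps, hs⟩ hpx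

theorem sq_dvd_mul_iff_of_squarefree {s p : ℕ} (hs : Squarefree s) (hp : p ∈ s.primeFactors)
    (x : ℤ) : (p : ℤ) ^ 2 ∣ s * x ↔ (p : ℤ) ∣ x := by
  obtain ⟨hprime, ⟨t, rfl⟩, -⟩ := Nat.mem_primeFactors.1 hp
  have hp0 : (p : ℤ) ≠ 0 := by exact_mod_cast hprime.ne_zero
  have hpt : ¬ (p : ℤ) ∣ t := by
    rw [Int.natCast_dvd_natCast]
    intro h
    exact hprime.prime.not_isUnit (hs p (Nat.mul_dvd_mul_left p h))
  rw [pow_two, Nat.cast_mul, mul_assoc, mul_dvd_mul_iff_left hp0,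
    (Nat.prime_iff_prime_int.1 hprime).dvd_mul]
  tauto

theorem forall_isEisensteinVec_iff {m s : ℕ} (hs : Squarefree s) (a : Fin (m + 2) → ℤ) :
    (∀ p ∈ s.primeFactors, IsEisensteinVec a p) ↔
      (∀ i : Fin (m + 1), (s : ℤ) ∣ a i.castSucc) ∧ (a 0 / s).natAbs.Coprime s ∧
        (a (Fin.last (m + 1))).natAbs.Coprime s := by
  rw [natAbs_coprime_iff hs.ne_zero, natAbs_coprime_iff hs.ne_zero]
  have hdvd : (∀ i : Fin (m + 1), (s : ℤ) ∣ a i.castSucc) ↔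
      ∀ p ∈ s.primeFactors, ∀ i : Fin (m + 1), (p : ℤ) ∣ a i.castSucc :=
    ⟨fun h p hp i => (Int.natCast_dvd_natCast.2 (Nat.dvd_of_mem_primeFactors hp)).trans (h i),
      fun h i => natCast_dvd_of_squarefree hs fun p hp => h p hp i⟩
  have hzero (h : ∀ i : Fin (m + 1), (s : ℤ) ∣ a i.castSucc) (p : ℕ) (hp : p ∈ s.primeFactors) :
      (p : ℤ) ^ 2 ∣ a 0 ↔ (p : ℤ) ∣ a 0 / s := by
    rw [← sq_dvd_mul_iff_of_squarefree hs hp, Int.mul_ediv_cancel' (show (s : ℤ) ∣ a 0 from h 0)]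
  constructor
  · intro h
    have h1 := hdvd.2 fun p hp => (h p hp).1
    exact ⟨h1, fun p hp => (hzero h1 p hp).not.1 (h p hp).2.1, fun p hp => (h p hp).2.2⟩
  · rintro ⟨h1, h2, h3⟩ p hp
    exact ⟨hdvd.1 h1 p hp, (hzero h1 p hp).not.2 (h2 p hp), h3 p hp⟩

open Classical in
/-- The number of coefficient vectors of height at most `H` that are Eisenstein at every prime
dividing `s`. -/
noncomputable def eisensteinCount (m H s : ℕ) : ℕ :=
  ((coeffBox m H).filter fun a => ∀ p ∈ s.primeFactors, IsEisensteinVec a p).card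

theorem eisensteinCount_eq (m H : ℕ) {s : ℕ} (hs : Squarefree s) :
    eisensteinCount m H s =
      (coprimeIcc (H / s) s).card * ((2 * (H / s) + 1) ^ m * (coprimeIcc H s).card) := by
  classical
  have hs0 : 0 < s := hs.ne_zero.bot_lt
  let box := Finset.Icc (-(H : ℤ)) H
  let T : Fin (m + 2) → Finset ℤ :=
    Fin.cons (box.filter fun x => (s : ℤ) ∣ x ∧ (x / s).natAbs.Coprime s)
      (Fin.snoc (fun _ : Fin m => box.filter fun x => (s : ℤ) ∣ x) (coprimeIcc H s))
  have hT : ((coeffBox m H).filter fun a => ∀ p ∈ s.primeFactors, IsEisensteinVec a p) =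
      Fintype.piFinset T := by
    ext a
    simp only [Finset.mem_filter, forall_isEisensteinVec_iff hs, coeffBox, Fintype.mem_piFinset]
    rw [show Fin.last (m + 1) = (Fin.last m).succ from rfl, Fin.forall_fin_succ,
      Fin.forall_fin_succ', Fin.forall_fin_succ (n := m),
      Fin.forall_fin_succ (n := m + 1), Fin.forall_fin_succ' (n := m)]
    simp only [T, Fin.cons_zero, Fin.cons_succ, Fin.snoc_castSucc, Fin.snoc_last, Fin.castSucc_zero,
      ← Fin.succ_castSucc, Finset.mem_filter, coprimeIcc, forall_and, box]
    tauto
  rw [eisensteinCount, hT, Fintype.card_piFinset, Fin.prod_univ_succ, Fin.prod_univ_castSucc]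
  simp only [T, Fin.cons_zero, Fin.cons_succ, Fin.snoc_castSucc, Fin.snoc_last, box,
    card_filter_dvd_Icc H hs0, Finset.prod_const, Finset.card_univ, Fintype.card_fin]
  rw [card_filter_dvd_and_Icc H hs0 (fun x => x.natAbs.Coprime s)]
  rfl

open ArithmeticFunction Classical in
theorem sum_moebius_ite_isEisensteinVec {m H : ℕ} (hH : 1 ≤ H) {a : Fin (m + 2) → ℤ}
    (ha : a ∈ coeffBox m H) :
    ∑ s ∈ Finset.Icc 1 H, (if ∀ p ∈ s.primeFactors, IsEisensteinVec a p then moebius s else 0) =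
      if ∃ p : ℕ, p.Prime ∧ IsEisensteinVec a p then 0 else 1 := by
  let P := (Finset.Icc 1 H).filter fun p => p.Prime ∧ IsEisensteinVec a p
  let M := ∏ p ∈ P, p
  have hne {p : ℕ} (he : IsEisensteinVec a p) : a 0 ≠ 0 := fun h => he.2.1 (by simp [h])
  have hprime : ∀ p ∈ P, p.Prime := fun p hp => (Finset.mem_filter.1 hp).2.1
  have hM : M.primeFactors = P := Nat.primeFactors_prod hprime
  have hM0 : M ≠ 0 := Finset.prod_ne_zero_iff.2 fun p hp => (hprime p hp).ne_zero
  have hMa : M ∣ (a 0).natAbs := Finset.prod_primes_dvd _ (fun p hp => (hprime p hp).prime)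
    fun p hp => Int.natCast_dvd.1 ((Finset.mem_filter.1 hp).2.2.1 0)
  have hmem (p : ℕ) : p ∈ P ↔ p.Prime ∧ IsEisensteinVec a p := by
    refine ⟨fun h => (Finset.mem_filter.1 h).2, fun h => Finset.mem_filter.2 ⟨?_, h⟩⟩
    exact Finset.mem_Icc.2 ⟨h.1.one_le, (Nat.le_of_dvd (Int.natAbs_pos.2 (hne h.2))
      (Int.natCast_dvd.1 (h.2.1 0))).trans (mem_coeffBox.1 ha 0)⟩
  have hMH : M ≤ H := by
    by_cases h : P = ∅
    · simpa [M, h] using hH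
    · obtain ⟨p, hp⟩ := Finset.nonempty_iff_ne_empty.2 h
      exact (Nat.le_of_dvd (Int.natAbs_pos.2 (hne ((hmem p).1 hp).2)) hMa).trans
        (mem_coeffBox.1 ha 0)
  have hM1 : M = 1 ↔ ¬ ∃ p : ℕ, p.Prime ∧ IsEisensteinVec a p := by
    simp only [← hmem]
    constructor
    · rintro h ⟨p, hp⟩
      rw [← hM, h] at hp
      simp at hp
    · intro h
      have : P = ∅ := Finset.eq_empty_of_forall_notMem fun p hp => h ⟨p, hp⟩
      simp [M, this]
  have hsum : ∑ s ∈ Finset.Icc 1 H,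
      (if ∀ p ∈ s.primeFactors, IsEisensteinVec a p then moebius s else 0) =
        ∑ s ∈ M.divisors, moebius s := by
    symm
    rw [← Finset.sum_filter]
    refine Finset.sum_subset_zero_on_sdiff ?_ ?_ fun _ _ => rfl
    · intro s hs
      have hsM := Nat.dvd_of_mem_divisors hs
      refine Finset.mem_filter.2 ⟨Finset.mem_Icc.2 ⟨Nat.pos_of_mem_divisors hs,
        (Nat.le_of_dvd hM0.bot_lt hsM).trans hMH⟩, fun p hp => ?_⟩
      exact ((hmem p).1 (hM ▸ Nat.primeFactors_mono hsM hM0 hp)).2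
    · intro s hs
      simp only [Finset.mem_sdiff, Finset.mem_filter, Nat.mem_divisors] at hs
      refine moebius_eq_zero_of_not_squarefree fun hsq => hs.2 ⟨?_, hM0⟩
      rw [← Nat.prod_primeFactors_of_squarefree hsq, Nat.prod_primeFactors_dvd_iff hM0, hM]
      exact fun p hp => (hmem p).2 ⟨Nat.prime_of_mem_primeFactors hp, hs.1.2 p hp⟩
  rw [hsum, sum_divisors_moebius]
  by_cases h : ∃ p : ℕ, p.Prime ∧ IsEisensteinVec a p
  · rw [if_pos h, if_neg (fun h1 => hM1.1 h1 h)]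
  · rw [if_neg h, if_pos (hM1.2 h)]

open ArithmeticFunction in
theorem card_eisensteinSet_eq_neg_sum (m : ℕ) {H : ℕ} (hH : 1 ≤ H) :
    (Nat.card (EisensteinSet (m + 1) H) : ℤ) =
      -∑ s ∈ Finset.Icc 2 H, moebius s * eisensteinCount m H s := by
  classical
  have h1 : (Nat.card (EisensteinSet (m + 1) H) : ℤ) =
      (coeffBox m H).card - ∑ s ∈ Finset.Icc 1 H, moebius s * eisensteinCount m H s := by
    have hcount (s : ℕ) : moebius s * (eisensteinCount m H s : ℤ) = ∑ a ∈ coeffBox m H,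
        if ∀ p ∈ s.primeFactors, IsEisensteinVec a p then moebius s else 0 := by
      rw [← Finset.sum_filter, Finset.sum_const, nsmul_eq_mul, mul_comm, eisensteinCount]
    simp only [hcount]
    rw [Finset.sum_comm, Finset.sum_congr rfl fun a ha => sum_moebius_ite_isEisensteinVec hH ha,
      card_eisensteinSet_eq, Finset.card_filter, Finset.card_eq_sum_ones]
    push_cast
    rw [← Finset.sum_sub_distrib]
    exact Finset.sum_congr rfl fun a _ => by split_ifs <;> rfl
  have h2 : eisensteinCount m H 1 = (coeffBox m H).card := by simp [eisensteinCount]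
  rw [h1, ← Finset.add_sum_Ioc_eq_sum_Icc hH, h2, moebius_apply_one]
  rw [show Finset.Ioc 1 H = Finset.Icc 2 H from rfl]
  ring

/-- The density `φ(s)² / s^{n+2}`, `n = m + 1`, of the coefficient vectors that are Eisenstein at
every prime dividing the squarefree number `s`. -/
noncomputable def eisensteinDensity (m s : ℕ) : ℝ := (s.totient : ℝ) ^ 2 / (s : ℝ) ^ (m + 3)

theorem eisensteinDensity_nonneg (m s : ℕ) : 0 ≤ eisensteinDensity m s := by
  unfold eisensteinDensity; positivity

theorem eisensteinDensity_le (m s : ℕ) : eisensteinDensity m s ≤ 1 / (s : ℝ) ^ (m + 1) := by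
  rcases Nat.eq_zero_or_pos s with rfl | hs
  · simp [eisensteinDensity]
  have hs' : (0 : ℝ) < s := by exact_mod_cast hs
  have h : (s.totient : ℝ) ≤ s := by exact_mod_cast Nat.totient_le s
  rw [eisensteinDensity, div_le_div_iff₀ (by positivity) (by positivity), one_mul,
    show (s : ℝ) ^ (m + 3) = (s : ℝ) ^ 2 * (s : ℝ) ^ (m + 1) by ring]
  gcongr

open ArithmeticFunction in
theorem abs_moebius_mul_le (s : ℕ) (x : ℝ) : |(moebius s : ℝ) * x| ≤ |x| := by
  have hmu : |(moebius s : ℝ)| ≤ 1 := by exact_mod_cast abs_moebius_le_one (n := s)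
  rw [abs_mul]
  exact mul_le_of_le_one_left (abs_nonneg _) hmu

open ArithmeticFunction in
theorem summable_abs_moebius_mul_eisensteinDensity {m : ℕ} (hm : 1 ≤ m) :
    Summable fun s : ℕ => |(moebius s : ℝ) * eisensteinDensity m s| := by
  refine Summable.of_nonneg_of_le (fun _ => abs_nonneg _) (fun s => ?_)
    (Real.summable_one_div_nat_pow.2 (show 1 < m + 1 by omega))
  exact (abs_moebius_mul_le s _).trans
    ((abs_of_nonneg (eisensteinDensity_nonneg m s)).le.trans (eisensteinDensity_le m s))

open ArithmeticFunction in
theorem hasSum_moebius_mul_eisensteinDensity {m : ℕ} (hm : 1 ≤ m) :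
    HasSum (fun s : ℕ => (moebius s : ℝ) * eisensteinDensity m s) (1 - rho (m + 1)) := by
  have hsum := summable_abs_moebius_mul_eisensteinDensity hm
  have hprod := EulerProduct.eulerProduct_tprod
    (f := fun s : ℕ => (moebius s : ℝ) * eisensteinDensity m s) (by simp [eisensteinDensity])
    (fun {a b} hab => by
      simp only [eisensteinDensity, isMultiplicative_moebius.map_mul_of_coprime hab,
        Nat.totient_mul hab]
      push_cast
      rw [mul_pow, mul_pow]
      ring) hsum (by simp)
  have hterm (p : Nat.Primes) :
      ∑' e : ℕ, (moebius ((p : ℕ) ^ e) : ℝ) * eisensteinDensity m ((p : ℕ) ^ e) =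
        1 - ((p : ℕ) - 1 : ℝ) ^ 2 / ((p : ℕ) : ℝ) ^ (m + 1 + 2) := by
    rw [tsum_eq_sum (s := Finset.range 2)]
    · simp [Finset.sum_range_succ, eisensteinDensity, moebius_apply_prime p.2,
        Nat.totient_prime p.2, Nat.cast_sub p.2.one_le]
      ring
    · intro e he
      have he : 1 < e := by simpa using he
      rw [moebius_apply_prime_pow p.2 (by omega), if_neg (by omega)]
      simp
  simp only [hterm] at hprod
  rw [rho, hprod, sub_sub_cancel]
  exact hsum.of_abs.hasSum

/-- Error made by replacing the factors of `B * (A ^ m * D)` by approximations. -/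
theorem abs_mul_pow_mul_sub_le {A B D α β δ τ L M : ℝ} {m : ℕ} (hm : m ≠ 0) (hA : 0 ≤ A)
    (hD : 0 ≤ D) (hB : 0 ≤ B) (hα : 0 ≤ α) (hβ : 0 ≤ β) (hAL : A ≤ L) (hBL : B ≤ L) (hDM : D ≤ M)
    (hαL : α ≤ L) (hβL : β ≤ L) (hLM : L ≤ M) (hτ : 1 ≤ τ) (hAα : |A - α| ≤ 1)
    (hBβ : |B - β| ≤ τ) (hDδ : |D - δ| ≤ τ) :
    |B * (A ^ m * D) - β * (α ^ m * δ)| ≤ (m + 2) * τ * (L ^ m * M) := by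
  have hL : 0 ≤ L := hA.trans hAL
  have hM : 0 ≤ M := hL.trans hLM
  have hpow : |A ^ m - α ^ m| ≤ m * L ^ (m - 1) := by
    calc |A ^ m - α ^ m| ≤ |A - α| * m * max |A| |α| ^ (m - 1) := abs_pow_sub_pow_le ..
      _ ≤ 1 * m * L ^ (m - 1) := by
        rw [abs_of_nonneg hA, abs_of_nonneg hα]
        gcongr
        exact max_le hAL hαL
      _ = _ := by ring
  have hLm : L ^ (m - 1) * L = L ^ m := pow_sub_one_mul hm L
  have e : B * (A ^ m * D) - β * (α ^ m * δ) =
      (A ^ m - α ^ m) * B * D + α ^ m * (B - β) * D + α ^ m * β * (D - δ) := by ring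
  have h1 : |(A ^ m - α ^ m) * B * D| ≤ m * τ * (L ^ m * M) := by
    rw [abs_mul, abs_mul, abs_of_nonneg hB, abs_of_nonneg hD]
    calc _ ≤ m * L ^ (m - 1) * L * M := by gcongr
      _ = m * 1 * (L ^ m * M) := by rw [← hLm]; ring
      _ ≤ _ := by gcongr
  have h2 : |α ^ m * (B - β) * D| ≤ τ * (L ^ m * M) := by
    rw [abs_mul, abs_mul, abs_of_nonneg hD, abs_of_nonneg (pow_nonneg hα m)]
    calc _ ≤ L ^ m * τ * M := by gcongr
      _ = _ := by ring
  have h3 : |α ^ m * β * (D - δ)| ≤ τ * (L ^ m * M) := by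
    rw [abs_mul, abs_mul, abs_of_nonneg hβ, abs_of_nonneg (pow_nonneg hα m)]
    calc _ ≤ L ^ m * M * τ := by gcongr; exact hβL.trans hLM
      _ = _ := by ring
  rw [e]
  linarith [abs_add_three ((A ^ m - α ^ m) * B * D) (α ^ m * (B - β) * D) (α ^ m * β * (D - δ))]

theorem card_coprimeIcc_le (N s : ℕ) : (coprimeIcc N s).card ≤ 2 * N + 1 := by
  refine (Finset.card_filter_le _ _).trans ?_
  rw [Int.card_Icc]
  omega

theorem abs_eisensteinCount_sub_le {m H s : ℕ} (hm : 2 ≤ m) (hs : Squarefree s) (hsH : s ≤ H) :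
    |(eisensteinCount m H s : ℝ) - (2 * H) ^ (m + 2) * eisensteinDensity m s| ≤
      2 * (m + 2) * 3 ^ (m + 1) * (H : ℝ) ^ (m + 1) * (√s / (s : ℝ) ^ 2) := by
  have hs0 : 0 < s := hs.ne_zero.bot_lt
  have hs1 : (1 : ℝ) ≤ s := by exact_mod_cast hs0
  have hs' : (0 : ℝ) < s := by linarith
  have hsH' : (s : ℝ) ≤ H := by exact_mod_cast hsH
  have hH : (0 : ℝ) < H := by linarith
  have hHs : 1 ≤ (H : ℝ) / s := by rwa [one_le_div hs']
  have hφ : (s.totient : ℝ) / s ≤ 1 := by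
    rw [div_le_one hs']; exact_mod_cast Nat.totient_le s
  have hα : 2 * (H : ℝ) / s ≤ 3 * H / s := by gcongr; norm_num
  have hA : ((2 * (H / s) + 1 : ℕ) : ℝ) ≤ 3 * H / s := by
    have h := (abs_le.1 (abs_two_mul_div_add_one_sub_le H hs0)).2
    rw [mul_div_assoc] at h ⊢
    linarith
  have hD := abs_card_coprimeIcc_sub_le H one_pos hs0
  rw [Nat.div_one, Nat.cast_one, div_one] at hD
  have hτ : (1 : ℝ) ≤ s.divisors.card := by
    exact_mod_cast Finset.card_pos.2 ⟨1, Nat.one_mem_divisors.2 hs0.ne'⟩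
  have key := abs_mul_pow_mul_sub_le (m := m) (M := 3 * H) (by omega) (Nat.cast_nonneg _)
    (Nat.cast_nonneg (coprimeIcc H s).card) (Nat.cast_nonneg (coprimeIcc (H / s) s).card)
    (by positivity) (by positivity) hA
    ((Nat.cast_le.2 (card_coprimeIcc_le (H / s) s)).trans hA)
    (by
      calc ((coprimeIcc H s).card : ℝ) ≤ 2 * H + 1 := by exact_mod_cast card_coprimeIcc_le H s
        _ ≤ 3 * H := by linarith)
    hα ((mul_le_of_le_one_right (by positivity) hφ).trans hα)
    (div_le_self (by positivity) hs1) hτ (abs_two_mul_div_add_one_sub_le H hs0)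
    (abs_card_coprimeIcc_sub_le H hs0 hs0) hD
  have emain : (2 * (H : ℝ)) ^ (m + 2) * eisensteinDensity m s =
      2 * H / s * (s.totient / s) * ((2 * H / s) ^ m * (2 * H * (s.totient / s))) := by
    rw [eisensteinDensity, div_pow]
    field_simp
    ring
  rw [eisensteinCount_eq m H hs, emain]
  push_cast at key ⊢
  refine key.trans ?_
  have hpow : (s : ℝ) ^ 2 ≤ (s : ℝ) ^ m := pow_le_pow_right₀ hs1 hm
  calc ((m : ℝ) + 2) * s.divisors.card * ((3 * H / s) ^ m * (3 * H))
      = (m + 2) * s.divisors.card * (3 ^ (m + 1) * H ^ (m + 1) / s ^ m) := by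
        rw [div_pow, mul_pow]; ring
    _ ≤ (m + 2) * (2 * √s) * (3 ^ (m + 1) * H ^ (m + 1) / s ^ 2) := by
        gcongr
        exact card_divisors_le_two_mul_sqrt s
    _ = _ := by ring

theorem eisensteinDensity_mul_le_of_lt {m H s : ℕ} (hm : 2 ≤ m) (hsH : H < s) :
    (2 * (H : ℝ)) ^ (m + 2) * eisensteinDensity m s ≤
      2 * (m + 2) * 3 ^ (m + 1) * (H : ℝ) ^ (m + 1) * (√s / (s : ℝ) ^ 2) := by
  have hs1 : (1 : ℝ) ≤ s := by exact_mod_cast (show 1 ≤ s by omega)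
  have hs' : (0 : ℝ) < s := by linarith
  have hsH' : (H : ℝ) ≤ s := by exact_mod_cast hsH.le
  have h3 : (2 : ℝ) ^ (m + 1) ≤ 3 ^ (m + 1) := by gcongr; norm_num
  calc (2 * (H : ℝ)) ^ (m + 2) * eisensteinDensity m s
      ≤ (2 * (H : ℝ)) ^ (m + 2) * (1 / (s : ℝ) ^ (m + 1)) := by
        gcongr; exact eisensteinDensity_le m s
    _ = 2 * 2 ^ (m + 1) * H ^ (m + 1) * (H / s ^ (m + 1)) := by rw [mul_pow]; ring
    _ ≤ 2 * (m + 2) * 3 ^ (m + 1) * H ^ (m + 1) * (√s / s ^ 2) := by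
        have hm0 : (0 : ℝ) ≤ m := Nat.cast_nonneg m
        have hdiv : (H : ℝ) / s ^ (m + 1) ≤ √s / s ^ 2 := by
          calc (H : ℝ) / s ^ (m + 1) ≤ s / s ^ (m + 1) := by gcongr
            _ = 1 / s ^ m := by rw [pow_succ]; field_simp
            _ ≤ √s / s ^ 2 := by
              gcongr
              exact Real.one_le_sqrt.2 hs1
        refine mul_le_mul ?_ hdiv (by positivity) (by positivity)
        gcongr
        linarith

theorem summable_sqrt_div_sq : Summable fun s : ℕ => √(s : ℝ) / (s : ℝ) ^ 2 := by
  refine (Real.summable_one_div_nat_rpow.2 (show (1 : ℝ) < 3 / 2 by norm_num)).congr fun s => ?_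
  rcases Nat.eq_zero_or_pos s with rfl | hs
  · simp
  have hs' : (0 : ℝ) < s := by exact_mod_cast hs
  rw [Real.sqrt_eq_rpow, ← Real.rpow_natCast, ← Real.rpow_sub hs', one_div, ← Real.rpow_neg hs'.le]
  norm_num

/-- For `n > 2`: `#E_n(H) = ρₙ 2ⁿ⁺¹ Hⁿ⁺¹ + O(Hⁿ)`. -/
theorem card_eisensteinSet (n : ℕ) (hn : 2 < n) :
    ∃ C : ℝ, 0 < C ∧ ∀ H : ℕ, 1 ≤ H →
      |(Nat.card (EisensteinSet n H) : ℝ) - rho n * 2^(n + 1) * (H : ℝ)^(n + 1)| ≤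
        C * (H : ℝ)^n := by
  classical
  obtain ⟨m, rfl⟩ : ∃ m, n = m + 1 := ⟨n - 1, by omega⟩
  have hm : 2 ≤ m := by omega
  have hW := summable_sqrt_div_sq
  have hW0 : 0 ≤ ∑' s : ℕ, √(s : ℝ) / (s : ℝ) ^ 2 := tsum_nonneg fun s => by positivity
  refine ⟨2 * (m + 2) * 3 ^ (m + 1) * (∑' s : ℕ, √(s : ℝ) / (s : ℝ) ^ 2 + 1), by positivity,
    fun H hH => ?_⟩
  let mu : ℕ → ℝ := fun s => (ArithmeticFunction.moebius s : ℝ)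
  let count : ℕ → ℝ := fun s => if s ∈ Finset.Icc 2 H then mu s * eisensteinCount m H s else 0
  let err : ℕ → ℝ := fun s => count s -
    (2 * H) ^ (m + 2) * (mu s * eisensteinDensity m s - if s = 1 then 1 else 0)
  have hcount : HasSum count (-(Nat.card (EisensteinSet (m + 1) H) : ℝ)) := by
    have h := congrArg (Int.cast : ℤ → ℝ) (card_eisensteinSet_eq_neg_sum m hH)
    push_cast at h
    rw [h, neg_neg]
    have hfin : HasSum count (∑ s ∈ Finset.Icc 2 H, count s) :=
      hasSum_sum_of_ne_finset_zero fun s hs => if_neg hs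
    rwa [Finset.sum_congr rfl fun s hs => if_pos hs] at hfin
  have herr : HasSum err (-(Nat.card (EisensteinSet (m + 1) H) : ℝ) -
      (2 * H) ^ (m + 2) * (1 - rho (m + 1) - 1)) :=
    hcount.sub (((hasSum_moebius_mul_eisensteinDensity (by omega)).sub
      (hasSum_ite_eq 1 (1 : ℝ))).mul_left _)
  have hbound (s : ℕ) : ‖err s‖ ≤
      2 * (m + 2) * 3 ^ (m + 1) * (H : ℝ) ^ (m + 1) * (√s / (s : ℝ) ^ 2) := by
    rw [Real.norm_eq_abs]
    by_cases hsq : Squarefree s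
    · by_cases h1 : s = 1
      · subst h1
        simp only [err, count, mu]
        simp [eisensteinDensity]
        positivity
      have hs0 := hsq.ne_zero
      by_cases hsH : s ≤ H
      · have e : err s = mu s * ((eisensteinCount m H s : ℝ) -
            (2 * H) ^ (m + 2) * eisensteinDensity m s) := by
          simp only [err, count]
          rw [if_pos (Finset.mem_Icc.2 ⟨by omega, hsH⟩), if_neg h1]
          ring
        rw [e]
        exact (abs_moebius_mul_le s _).trans (abs_eisensteinCount_sub_le hm hsq hsH)
      · have e : err s = mu s * -((2 * H) ^ (m + 2) * eisensteinDensity m s) := by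
          simp only [err, count]
          rw [if_neg (by simp; omega), if_neg h1]
          ring
        have h0 := eisensteinDensity_nonneg m s
        rw [e]
        refine (abs_moebius_mul_le s _).trans ?_
        rw [abs_neg, abs_of_nonneg (by positivity)]
        exact eisensteinDensity_mul_le_of_lt hm (not_le.1 hsH)
    · have h1 : s ≠ 1 := fun h => hsq (h ▸ squarefree_one)
      have e : err s = 0 := by
        simp [err, count, mu, ArithmeticFunction.moebius_eq_zero_of_not_squarefree hsq, h1]
      rw [e, abs_zero]
      positivity
  have h := tsum_of_norm_bounded (hW.hasSum.mul_left _) hbound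
  rw [herr.tsum_eq, Real.norm_eq_abs, ← abs_neg] at h
  calc |(Nat.card (EisensteinSet (m + 1) H) : ℝ) - rho (m + 1) * 2 ^ (m + 1 + 1) *
        (H : ℝ) ^ (m + 1 + 1)| ≤ _ := le_of_eq_of_le (by rw [mul_pow]; congr 1; ring) h
    _ = 2 * (m + 2) * 3 ^ (m + 1) * (∑' s : ℕ, √(s : ℝ) / (s : ℝ) ^ 2) * (H : ℝ) ^ (m + 1) := by
        ring
    _ ≤ _ := by
        gcongr
        linarith
end
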